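/- Let L'' be the ℚ-linear subspace of ℝ spanned by (π − 1)⁻¹, and let D'' be the ℚ-linear subspace of ℝ spanned by {πⁿ : n ∈ ℤ}. Then L'' and D'' are nonzero, D'' ∩ L'' = {0}, {π·d : d ∈ D''} = D'', and (π − 1)·l ∈ D'' for all l ∈ L''. (Hence, since π ≠ 1, the pair D'', L'' fails the rigidity criterion that the only γ > 0 with γ·D'' = D'' and (γ − 1)·L'' ⊆ D'' is γ = 1.) -/

import Mathlib

open Polynomial Filter
open scoped Nat

lemma IsIntegral.pow_mul_aeval {A : Type*} [CommRing A] {a : ℤ} {b : A}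
    (h : IsIntegral ℤ ((a : A) * b)) (g : ℤ[X]) {m : ℕ} (hm : g.natDegree ≤ m) :
    IsIntegral ℤ ((a : A) ^ m * aeval b g) := by
  rw [aeval_eq_sum_range' (Nat.lt_succ_of_le hm), Finset.mul_sum]
  refine IsIntegral.sum _ fun j hj ↦ ?_
  have hj : j ≤ m := Nat.lt_succ_iff.mp (Finset.mem_range.mp hj)
  have : (a : A) ^ m * g.coeff j • b ^ j
      = algebraMap ℤ A (g.coeff j * a ^ (m - j)) * ((a : A) * b) ^ j := by
    conv_lhs => rw [← Nat.sub_add_cancel hj, pow_add]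
    simp [mul_pow]
    ring
  rw [this]
  exact isIntegral_algebraMap.mul (h.pow j)

theorem exists_prime_mul_pow_div_factorial_lt_one (N : ℕ) (A c : ℝ) :
    ∃ p > N, p.Prime ∧ A * (c ^ p / (p - 1)!) < 1 := by
  have h := (FloorSemiring.tendsto_pow_div_factorial_atTop c).const_mul (A * c)
  rw [mul_zero] at h
  obtain ⟨M, hM⟩ := eventually_atTop.mp (h.eventually_lt_const zero_lt_one)
  obtain ⟨p, hp, hp'⟩ := Nat.exists_infinite_primes (N + M + 1)
  refine ⟨p, by omega, hp', ?_⟩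
  have hpow : c ^ p = c ^ (p - 1) * c := by rw [← pow_succ, Nat.sub_add_cancel hp'.one_le]
  calc A * (c ^ p / (p - 1)!) = A * c * (c ^ (p - 1) / (p - 1)!) := by rw [hpow]; ring
    _ < 1 := hM (p - 1) (by omega)

theorem intCast_add_sum_exp_ne_zero {ι : Type*} (s : Finset ι) (β : ι → ℂ)
    (hβ : ∀ i ∈ s, β i ≠ 0) (halg : ∀ i ∈ s, IsAlgebraic ℤ (β i))
    (hrat : ∀ g : ℤ[X], ∑ i ∈ s, aeval (β i) g ∈ (algebraMap ℚ ℂ).range) {k : ℤ} (hk : k ≠ 0) :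
    (k : ℂ) + ∑ i ∈ s, Complex.exp (β i) ≠ 0 := by
  classical
  intro h0
  obtain ⟨f, hf0, hf⟩ : ∃ f : ℤ[X], f.eval 0 ≠ 0 ∧ ∀ i ∈ s, β i ∈ f.aroots ℂ := by
    have hex (i : ι) : ∃ q : ℤ[X], q.eval 0 ≠ 0 ∧ (i ∈ s → aeval (β i) q = 0) := by
      by_cases hi : i ∈ s
      · obtain ⟨q, hq, hq'⟩ := (halg i hi).exists_nonzero_coeff_and_aeval_eq_zero
          (mem_nonZeroDivisors_of_ne_zero (hβ i hi))
        exact ⟨q, by rwa [← coeff_zero_eq_eval_zero], fun _ ↦ hq'⟩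
      · exact ⟨1, by simp, fun h ↦ (hi h).elim⟩
    choose q hq hq' using hex
    have hne : (∏ i ∈ s, q i).eval 0 ≠ 0 := by
      rw [eval_prod]
      exact Finset.prod_ne_zero_iff.mpr fun i _ ↦ hq i
    refine ⟨∏ i ∈ s, q i, hne, fun i hi ↦ mem_aroots.mpr ⟨fun h ↦ hne (by simp [h]), ?_⟩⟩
    rw [map_prod]
    exact Finset.prod_eq_zero hi (hq' i hi)
  obtain ⟨a, ha, hint⟩ : ∃ a : ℤ, a ≠ 0 ∧ ∀ i ∈ s, IsIntegral ℤ ((a : ℂ) * β i) := by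
    have hex (i : ι) : ∃ a : ℤ, a ≠ 0 ∧ (i ∈ s → IsIntegral ℤ (a • β i)) := by
      by_cases hi : i ∈ s
      · obtain ⟨a, ha, h⟩ := (halg i hi).exists_integral_multiple
        exact ⟨a, ha, fun _ ↦ h⟩
      · exact ⟨1, one_ne_zero, fun h ↦ (hi h).elim⟩
    choose a ha h using hex
    refine ⟨∏ i ∈ s, a i, Finset.prod_ne_zero_iff.mpr fun i _ ↦ ha i, fun i hi ↦ ?_⟩
    rw [← zsmul_eq_mul, ← Finset.prod_erase_mul s a hi, mul_smul]
    exact (h i hi).smul _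
  obtain ⟨c, hc⟩ := LindemannWeierstrass.exp_polynomial_approx f hf0
  set d := f.natDegree
  obtain ⟨p, hpN, hp, hlt⟩ := exists_prime_mul_pow_div_factorial_lt_one
    ((f.eval 0).natAbs + a.natAbs + k.natAbs) s.card (|(a : ℝ)| ^ d * c)
  obtain ⟨n, hn, g, hg, happrox⟩ := hc p (by omega) hp
  obtain ⟨N, hN⟩ : ∃ N : ℤ, (N : ℂ) = (a : ℂ) ^ (p * d) * ∑ i ∈ s, aeval (β i) g := by
    obtain ⟨r, hr⟩ := hrat g
    have hI : IsIntegral ℤ ((a : ℂ) ^ (p * d) * ∑ i ∈ s, aeval (β i) g) := by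
      rw [Finset.mul_sum]
      exact IsIntegral.sum _ fun i hi ↦ (hint i hi).pow_mul_aeval g (hg.trans (Nat.sub_le _ _))
    have hr' : (a : ℂ) ^ (p * d) * ∑ i ∈ s, aeval (β i) g
        = algebraMap ℚ ℂ ((a : ℚ) ^ (p * d) * r) := by simp [← hr]
    rw [hr', isIntegral_algebraMap_iff (algebraMap ℚ ℂ).injective,
      IsIntegrallyClosed.isIntegral_iff] at hI
    obtain ⟨N, hN⟩ := hI
    exact ⟨N, by rw [hr', ← hN]; simp⟩
  have hpz : Prime (p : ℤ) := Nat.prime_iff_prime_int.mp hp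
  have hndvd {x : ℤ} (hx : x ≠ 0) (hxp : x.natAbs < p) : ¬ (p : ℤ) ∣ x := fun h ↦
    hxp.not_ge (Nat.le_of_dvd (Int.natAbs_pos.mpr hx) (Int.natCast_dvd.mp h))
  have hne : a ^ (p * d) * (n * k) + p * N ≠ 0 := fun h ↦ by
    have hdvd : (p : ℤ) ∣ a ^ (p * d) * (n * k) :=
      (dvd_add_left (dvd_mul_right _ N)).mp (h ▸ dvd_zero _)
    rcases hpz.dvd_or_dvd hdvd with h | h
    · exact hndvd ha (by omega) (hpz.dvd_of_dvd_pow h)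
    · exact (hpz.dvd_or_dvd h).elim hn (hndvd hk (by omega))
  have hval : ((a ^ (p * d) * (n * k) + p * N : ℤ) : ℂ)
      = -((a : ℂ) ^ (p * d) * ∑ i ∈ s, (n • Complex.exp (β i) - p • aeval (β i) g)) := by
    rw [Finset.sum_sub_distrib, ← Finset.smul_sum, ← Finset.smul_sum]
    push_cast
    rw [hN, zsmul_eq_mul, nsmul_eq_mul]
    linear_combination (a : ℂ) ^ (p * d) * n * h0
  have hle : ‖((a ^ (p * d) * (n * k) + p * N : ℤ) : ℂ)‖
      ≤ s.card * ((|(a : ℝ)| ^ d * c) ^ p / (p - 1)!) := by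
    rw [hval, norm_neg, norm_mul, norm_pow, Complex.norm_intCast]
    calc _ ≤ |(a : ℝ)| ^ (p * d) * (s.card • (c ^ p / (p - 1)!)) := by
          gcongr
          exact norm_sum_le_of_le _ (fun i hi ↦ happrox (hf i hi)) |>.trans_eq (by simp)
      _ = _ := by
          rw [mul_pow, ← pow_mul, mul_comm d p, nsmul_eq_mul]
          ring
  rw [Complex.norm_intCast] at hle
  have : (1 : ℝ) ≤ |((a ^ (p * d) * (n * k) + p * N : ℤ) : ℝ)| := by
    exact_mod_cast Int.one_le_abs hne
  linarith

open Complex in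
theorem exp_algHom_ne_neg_one {K : Type*} [Field K] [Algebra ℚ K] [FiniteDimensional ℚ K]
    [IsGalois ℚ K] (ψ : K →ₐ[ℚ] ℂ) (α : K) : exp (ψ α) ≠ -1 := by
  classical
  intro h
  let b (S : Finset Gal(K/ℚ)) : K := ∑ σ ∈ S, σ α
  have hprod : ∑ S, exp (ψ (b S)) = 0 := by
    have h0 : ∏ σ : Gal(K/ℚ), (1 + exp (ψ (σ α))) = 0 :=
      Finset.prod_eq_zero (Finset.mem_univ 1) (by simp [h])
    rw [Finset.prod_one_add, Finset.powerset_univ] at h0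
    rw [← h0]
    exact Finset.sum_congr rfl fun S _ ↦ by rw [map_sum, exp_sum]
  have hb (τ : Gal(K/ℚ)) (S : Finset Gal(K/ℚ)) :
      b ((Equiv.mulLeft τ).finsetCongr S) = τ (b S) := by
    simp [b, Equiv.finsetCongr_apply, Finset.sum_map]
  let s : Finset (Finset Gal(K/ℚ)) := {S | b S ≠ 0}
  let t : Finset (Finset Gal(K/ℚ)) := {S | ¬ b S ≠ 0}
  have ht : ((t.card : ℤ) : ℂ) + ∑ S ∈ s, exp (ψ (b S)) = 0 := by
    rw [← hprod, ← Finset.sum_filter_add_sum_filter_not Finset.univ (fun S ↦ b S ≠ 0), add_comm]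
    congr 1
    rw [Finset.sum_congr rfl (g := fun _ ↦ (1 : ℂ)) fun S hS ↦ ?_]
    · simp [t]
    · rw [not_not.mp (Finset.mem_filter.mp hS).2, map_zero, exp_zero]
  refine intCast_add_sum_exp_ne_zero s (fun S ↦ ψ (b S)) (fun S hS ↦ ?_) (fun S _ ↦ ?_)
    (fun g ↦ ?_) ?_ ht
  · simpa [s] using hS
  · exact (IsFractionRing.isAlgebraic_iff ℤ ℚ ℂ).mpr
      ((Algebra.IsAlgebraic.isAlgebraic (R := ℚ) (b S)).algHom ψ)
  · have hfix : ∑ S ∈ s, aeval (b S) g ∈ (⊥ : IntermediateField ℚ K) := by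
      rw [IsGalois.mem_bot_iff_fixed]
      intro τ
      rw [map_sum]
      refine Finset.sum_equiv (Equiv.mulLeft τ).finsetCongr (fun S ↦ ?_) fun S _ ↦ ?_
      · simp only [s, Finset.mem_filter_univ, hb, ne_eq, map_eq_zero]
      · rw [hb]
        exact (aeval_algHom_apply (τ.toAlgHom.restrictScalars ℤ) (b S) g).symm
    obtain ⟨r, hr⟩ := IntermediateField.mem_bot.mp hfix
    refine ⟨r, ?_⟩
    rw [← ψ.commutes r, hr, map_sum]
    exact Finset.sum_congr rfl fun S _ ↦
      (aeval_algHom_apply (ψ.restrictScalars ℤ) (b S) g).symm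
  · have : (∅ : Finset Gal(K/ℚ)) ∈ t := by simp [t, b]
    exact_mod_cast Finset.card_ne_zero_of_mem this

theorem transcendental_of_cexp_eq_neg_one {z : ℂ} (hz : Complex.exp z = -1) :
    Transcendental ℚ z := by
  intro halg
  have hint := halg.isIntegral
  let p := minpoly ℚ z
  let K := IntermediateField.adjoin ℚ (p.rootSet ℂ)
  have : IsSplittingField ℚ K p :=
    IntermediateField.adjoin_rootSet_isSplittingField (IsAlgClosed.splits _)
  have hfin : FiniteDimensional ℚ K := IsSplittingField.finiteDimensional K p
  have hgal : IsGalois ℚ K :=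
    IsGalois.of_separable_splitting_field (minpoly.irreducible hint).separable
  have hzK : z ∈ K := IntermediateField.subset_adjoin ℚ _
    ((mem_rootSet_of_ne (minpoly.ne_zero hint)).mpr (minpoly.aeval ℚ z))
  exact @exp_algHom_ne_neg_one K _ _ hfin hgal K.val ⟨z, hzK⟩ hz

theorem Real.transcendental_pi : Transcendental ℚ Real.pi := by
  intro h
  have hI : IsAlgebraic ℚ Complex.I :=
    ⟨X ^ 2 + 1, (monic_X_pow_add_C 1 two_ne_zero).ne_zero, by simp⟩
  exact transcendental_of_cexp_eq_neg_one Complex.exp_pi_mul_I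
    ((h.algebraMap (A := ℂ)).mul hI)

/-- Every element of the `ℚ`-span of the integer powers of `x` becomes a polynomial in `x` after
multiplication by a power of `x`. -/
theorem exists_pow_mul_eq_aeval_of_mem_span_zpow {K : Type*} [Field K] [Algebra ℚ K] {x y : K}
    (hx : x ≠ 0) (hy : y ∈ Submodule.span ℚ {z : K | ∃ n : ℤ, z = x ^ n}) :
    ∃ (m : ℕ) (g : ℚ[X]), x ^ m * y = aeval x g := by
  induction hy using Submodule.span_induction with
  | mem y hy =>
    obtain ⟨n, rfl⟩ := hy
    refine ⟨n.natAbs, X ^ (n.natAbs + n).toNat, ?_⟩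
    rw [map_pow, aeval_X, ← zpow_natCast, ← zpow_natCast, ← zpow_add₀ hx]
    congr 1
    omega
  | zero => exact ⟨0, 0, by simp⟩
  | add y z _ _ hy hz =>
    obtain ⟨m, g, hg⟩ := hy
    obtain ⟨n, h, hh⟩ := hz
    refine ⟨m + n, X ^ n * g + X ^ m * h, ?_⟩
    simp only [map_add, map_mul, map_pow, aeval_X, ← hg, ← hh]
    ring
  | smul a y _ hy =>
    obtain ⟨m, g, hg⟩ := hy
    exact ⟨m, a • g, by rw [map_smul, ← hg, mul_smul_comm]⟩

theorem Transcendental.inv_sub_one_notMem_span_zpow {K : Type*} [Field K] [Algebra ℚ K] {x : K}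
    (hx : Transcendental ℚ x) :
    (x - 1)⁻¹ ∉ Submodule.span ℚ {z : K | ∃ n : ℤ, z = x ^ n} := by
  intro hmem
  have hx0 : x ≠ 0 := fun h ↦ hx (h ▸ isAlgebraic_zero)
  have hx1 : x - 1 ≠ 0 := fun h ↦ hx (sub_eq_zero.mp h ▸ isAlgebraic_one)
  obtain ⟨m, g, hg⟩ := exists_pow_mul_eq_aeval_of_mem_span_zpow hx0 hmem
  have h : Polynomial.aeval x (X ^ m : ℚ[X]) = Polynomial.aeval x (g * (X - 1)) := by
    simp [← hg, hx1]
  have := congrArg (eval 1) (transcendental_iff_injective.mp hx h)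
  simp at this

theorem image_mul_span_zpow {K : Type*} [Field K] [Algebra ℚ K] {x : K} (hx : x ≠ 0) :
    (fun y : K ↦ x * y) '' (Submodule.span ℚ {z : K | ∃ n : ℤ, z = x ^ n} : Set K) =
      (Submodule.span ℚ {z : K | ∃ n : ℤ, z = x ^ n} : Set K) := by
  have h := Submodule.map_span (LinearMap.mulLeft ℚ x) {z : K | ∃ n : ℤ, z = x ^ n}
  have hset : LinearMap.mulLeft ℚ x '' {z : K | ∃ n : ℤ, z = x ^ n} =
      {z : K | ∃ n : ℤ, z = x ^ n} := by
    ext z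
    constructor
    · rintro ⟨_, ⟨n, rfl⟩, rfl⟩
      exact ⟨1 + n, by rw [zpow_one_add₀ hx]; rfl⟩
    · rintro ⟨n, rfl⟩
      exact ⟨x ^ (n - 1), ⟨n - 1, rfl⟩, by simp [← zpow_one_add₀ hx]⟩
  rw [hset] at h
  exact congrArg (fun S : Submodule ℚ K ↦ (S : Set K)) h


open Real in
/-- The multiplier criterion is not automatic: for `L'' = ℚ·(π−1)⁻¹` and
`D'' = span_ℚ {πⁿ : n ∈ ℤ}`, both are nonzero, they intersect trivially,
yet `π·D'' = D''` and `(π−1)·L'' ⊆ D''`. -/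
theorem multiplier_criterion_counterexample :
    (Submodule.span ℚ ({(π - 1)⁻¹} : Set ℝ) ≠ ⊥) ∧
    (Submodule.span ℚ {x : ℝ | ∃ n : ℤ, x = π ^ n} ≠ ⊥) ∧
    (Submodule.span ℚ {x : ℝ | ∃ n : ℤ, x = π ^ n} ⊓
      Submodule.span ℚ ({(π - 1)⁻¹} : Set ℝ) = ⊥) ∧
    ((fun x : ℝ => π * x) '' (Submodule.span ℚ {x : ℝ | ∃ n : ℤ, x = π ^ n} : Set ℝ) =
      (Submodule.span ℚ {x : ℝ | ∃ n : ℤ, x = π ^ n} : Set ℝ)) ∧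
    (∀ l ∈ Submodule.span ℚ ({(π - 1)⁻¹} : Set ℝ),
      (π - 1) * l ∈ Submodule.span ℚ {x : ℝ | ∃ n : ℤ, x = π ^ n}) := by
  have hπ1 : π - 1 ≠ 0 := fun h ↦ transcendental_pi (sub_eq_zero.mp h ▸ isAlgebraic_one)
  have hone : (1 : ℝ) ∈ Submodule.span ℚ {x : ℝ | ∃ n : ℤ, x = π ^ n} :=
    Submodule.subset_span ⟨0, by simp⟩
  refine ⟨?_, ?_, ?_, image_mul_span_zpow pi_ne_zero, ?_⟩
  · simpa [Submodule.span_singleton_eq_bot] using hπ1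
  · exact (Submodule.ne_bot_iff _).mpr ⟨1, hone, one_ne_zero⟩
  · rw [← disjoint_iff, Submodule.disjoint_span_singleton' (inv_ne_zero hπ1)]
    exact transcendental_pi.inv_sub_one_notMem_span_zpow
  · intro l hl
    obtain ⟨q, rfl⟩ := Submodule.mem_span_singleton.mp hl
    rw [mul_smul_comm, mul_inv_cancel₀ hπ1]
    exact Submodule.smul_mem _ q hone
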